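/- Let H : ℝ² → ℝ, H(x,y) = x⁴ + y⁴, and let R : ℝ² → ℝ², R(x,y) = (−y, x). Then there is no map Φ : ℝ × ℝ² → ℝ² of class C³ (jointly in all variables) such that Φ(0, p) = p and Φ(1, p) = R(p) for all p ∈ ℝ², and such that for every t ∈ [0,1]: H(Φ(t, p)) = H(p) for all p ∈ ℝ² and the map p ↦ Φ(t, p) has Jacobian determinant identically equal to 1 (i.e. Φ(t,·) preserves the area form dx∧dy). -/

import Mathlib

/-- The quarter-turn rotation `R(x,y) = (−y,x)` preserves `H = x⁴ + y⁴` and the area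
form, but cannot be joined to the identity by a `C³` homotopy through `H`-preserving
area-preserving maps. -/
theorem no_C3_H_preserving_symplectic_isotopy :
    ¬ ∃ Φ : ℝ × (ℝ × ℝ) → ℝ × ℝ,
        ContDiff ℝ 3 Φ ∧
        (∀ p : ℝ × ℝ, Φ (0, p) = p) ∧
        (∀ p : ℝ × ℝ, Φ (1, p) = (-p.2, p.1)) ∧
        (∀ t ∈ Set.Icc (0 : ℝ) 1, ∀ p : ℝ × ℝ,
          (Φ (t, p)).1 ^ 4 + (Φ (t, p)).2 ^ 4 = p.1 ^ 4 + p.2 ^ 4 ∧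
          LinearMap.det (fderiv ℝ (fun q => Φ (t, q)) p).toLinearMap = 1) := by
  rintro ⟨Φ, hC, h0, h1, hH⟩
  have hder : ∀ (t : ℝ) (v : ℝ × ℝ),
      HasDerivAt (fun s : ℝ => Φ (t, s • v)) (fderiv ℝ Φ (t, 0) (0, v)) 0 := by
    intro t v
    have hd : HasFDerivAt Φ (fderiv ℝ Φ (t, 0)) (t, (0 : ℝ) • v) := by
      rw [zero_smul]
      exact (hC.differentiable (by norm_num) _).hasFDerivAt
    have hg : HasDerivAt (fun s : ℝ => (t, s • v)) ((0 : ℝ), v) 0 := by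
      have h2 : HasDerivAt (fun s : ℝ => s • v) ((1 : ℝ) • v) 0 :=
        (hasDerivAt_id (0 : ℝ)).smul_const v
      rw [one_smul] at h2
      exact (hasDerivAt_const (0 : ℝ) t).prodMk h2
    exact hd.comp_hasDerivAt (0 : ℝ) hg
  have hL : ∀ t ∈ Set.Icc (0 : ℝ) 1, ∀ v : ℝ × ℝ,
      (fderiv ℝ Φ (t, 0) (0, v)).1 ^ 4 + (fderiv ℝ Φ (t, 0) (0, v)).2 ^ 4
        = v.1 ^ 4 + v.2 ^ 4 := by
    intro t ht v
    have hz : Φ (t, 0) = 0 := by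
      have h := (hH t ht 0).1
      simp only [Prod.fst_zero, Prod.snd_zero] at h
      have e1 : (Φ (t, 0)).1 ^ 4 = 0 := by
        nlinarith [sq_nonneg ((Φ (t, 0)).1 ^ 2), sq_nonneg ((Φ (t, 0)).2 ^ 2)]
      have e2 : (Φ (t, 0)).2 ^ 4 = 0 := by
        nlinarith [sq_nonneg ((Φ (t, 0)).1 ^ 2), sq_nonneg ((Φ (t, 0)).2 ^ 2)]
      exact Prod.ext (pow_eq_zero_iff (by norm_num) |>.1 e1)
        (pow_eq_zero_iff (by norm_num) |>.1 e2)
    have hs := (hder t v).tendsto_slope_zero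
    simp only [zero_add, zero_smul, hz, sub_zero] at hs
    have hc : Continuous (fun p : ℝ × ℝ => p.1 ^ 4 + p.2 ^ 4) := by fun_prop
    have hs2 := (hc.tendsto (fderiv ℝ Φ (t, 0) (0, v))).comp hs
    refine tendsto_nhds_unique hs2 (Filter.Tendsto.congr' ?_ tendsto_const_nhds)
    filter_upwards [self_mem_nhdsWithin] with s hs0
    have hs0 : s ≠ 0 := hs0
    have h := (hH t ht (s • v)).1
    simp only [Function.comp, Prod.smul_fst, Prod.smul_snd, smul_eq_mul, mul_pow] at h ⊢
    rw [← mul_add, h]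
    field_simp
  have hcont : Continuous (fun t : ℝ => (fderiv ℝ Φ (t, 0) (0, ((1 : ℝ), (0 : ℝ)))).1) := by
    have := hC.continuous_fderiv (by norm_num)
    fun_prop
  have ha0 : (fderiv ℝ Φ (0, 0) (0, ((1 : ℝ), (0 : ℝ)))).1 = 1 := by
    have h := hder 0 (1, 0)
    simp only [h0] at h
    have h2 : HasDerivAt (fun s : ℝ => s • ((1 : ℝ), (0 : ℝ))) ((1 : ℝ) • (1, 0)) 0 :=
      (hasDerivAt_id (0 : ℝ)).smul_const _
    rw [h.unique h2]
    simp
  have ha1 : (fderiv ℝ Φ (1, 0) (0, ((1 : ℝ), (0 : ℝ)))).1 = 0 := by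
    have h := hder 1 (1, 0)
    simp only [h1] at h
    have h2 : HasDerivAt (fun s : ℝ => s • ((0 : ℝ), (1 : ℝ))) ((1 : ℝ) • (0, 1)) 0 :=
      (hasDerivAt_id (0 : ℝ)).smul_const _
    have h3 : (fun s : ℝ => (-(s • ((1 : ℝ), (0 : ℝ))).2, (s • ((1 : ℝ), (0 : ℝ))).1))
        = fun s : ℝ => s • ((0 : ℝ), (1 : ℝ)) := by
      funext s
      simp
    rw [h3] at h
    rw [h.unique h2]
    simp
  obtain ⟨t, ht, hat⟩ : ∃ t ∈ Set.Icc (0 : ℝ) 1,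
      (fderiv ℝ Φ (t, 0) (0, ((1 : ℝ), (0 : ℝ)))).1 = 1 / 2 := by
    have := intermediate_value_Icc' (zero_le_one (α := ℝ)) hcont.continuousOn
    have hm := this (show (1 / 2 : ℝ) ∈ _ by
      simp only [ha0, ha1]
      constructor <;> norm_num)
    exact hm
  have k1 := hL t ht (1, 0)
  have k2 := hL t ht (0, 1)
  have k3 := hL t ht (1, 1)
  have k4 := hL t ht (1, -1)
  have e3 : ((0 : ℝ), ((1 : ℝ), (1 : ℝ))) = (0, (1, 0)) + (0, (0, 1)) := by simp
  have e4 : ((0 : ℝ), ((1 : ℝ), (-1 : ℝ))) = (0, (1, 0)) - (0, (0, 1)) := by simp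
  rw [e3, map_add] at k3
  rw [e4, map_sub] at k4
  simp only [Prod.fst_add, Prod.snd_add, Prod.fst_sub, Prod.snd_sub] at k1 k2 k3 k4
  rw [hat] at k1 k3 k4
  generalize (fderiv ℝ Φ (t, 0) (0, ((1 : ℝ), (0 : ℝ)))).2 = c at *
  generalize (fderiv ℝ Φ (t, 0) (0, ((0 : ℝ), (1 : ℝ)))).1 = b at *
  generalize (fderiv ℝ Φ (t, 0) (0, ((0 : ℝ), (1 : ℝ)))).2 = d at *
  have key : b ^ 2 / 4 + (c * d) ^ 2 = 0 := by linarith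
  have hb : b = 0 := by
    have : b ^ 2 = 0 := by nlinarith [sq_nonneg b, sq_nonneg (c * d)]
    exact pow_eq_zero_iff (by norm_num) |>.1 this
  have hcd : c * d = 0 := by
    have : (c * d) ^ 2 = 0 := by nlinarith [sq_nonneg b, sq_nonneg (c * d)]
    exact pow_eq_zero_iff (by norm_num) |>.1 this
  rcases mul_eq_zero.1 hcd with h | h
  · rw [h] at k1
    norm_num at k1
  · rw [h, hb] at k2
    norm_num at k2
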